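/- Let U ⊂ ℝ^l be compact. Endow the space 𝒫(U) of Borel probability measures on U with the 2-Wasserstein distance W_{2,U}, endow ℝ × 𝒫(U) with the metric d((x₁,q₁),(x₂,q₂)) := |x₁ − x₂| + W_{2,U}(q₁,q₂), and endow ℝ × U with the metric |x₁ − x₂| + |u₁ − u₂|. For ξ ∈ 𝒫₂(ℝ × 𝒫(U)) define 𝒫(ξ) ∈ 𝒫₂(ℝ × U) by 𝒫(ξ)(B) := ∫_{ℝ×𝒫(U)} (δ_x ⊗ q)(B) ξ(dx,dq) for Borel sets B ⊆ ℝ × U. Then for all ξ₁, ξ₂ ∈ 𝒫₂(ℝ × 𝒫(U)), W_{2,ℝ×U}(𝒫(ξ₁), 𝒫(ξ₂)) ≤ W_{2,ℝ×𝒫(U)}(ξ₁, ξ₂); i.e., the map ξ ↦ 𝒫(ξ) is 1-Lipschitz. -/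

import Mathlib

open Set MeasureTheory

/-- The squared 2-Wasserstein "distance" between two measures on `E`, relative to an
explicit squared-cost function `c`: the infimum over all couplings `π` of `μ` and `ν`
of `∫ c(x, y) dπ`. -/
noncomputable def W2sq {E : Type*} [MeasurableSpace E] (c : E → E → ℝ)
    (μ ν : Measure E) : ℝ :=
  sInf {r : ℝ | ∃ π : Measure (E × E),
    π.map Prod.fst = μ ∧ π.map Prod.snd = ν ∧ r = ∫ p, c p.1 p.2 ∂π}

/-- 2-Wasserstein distance relative to a squared cost `c`. -/
noncomputable def W2 {E : Type*} [MeasurableSpace E] (c : E → E → ℝ)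
    (μ ν : Measure E) : ℝ :=
  Real.sqrt (W2sq c μ ν)

/-- The map `𝒫 : 𝒫₂(ℝ × 𝒫(U)) → 𝒫₂(ℝ × U)`,
`𝒫(ξ)(B) = ∫_{ℝ×𝒫(U)} (δ_x ⊗ q)(B) ξ(dx, dq)`. -/
noncomputable def Pext {l : ℕ} (U : Set (EuclideanSpace ℝ (Fin l)))
    (ξ : Measure (ℝ × Measure U)) : Measure (ℝ × U) :=
  ξ.bind (fun p => (Measure.dirac p.1).prod p.2)

open ProbabilityTheory

namespace Stmt4Aux

/-- Total mass of the step density `θ`. -/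
noncomputable def mass {N : ℕ} (θ : Fin N → Fin N → ℝ) (w₁ w₂ : Fin N → ℝ) : ℝ :=
  ∑ i, ∑ j, θ i j * w₁ i * w₂ j

/-- Feasible sub-couplings. -/
def Feas {N : ℕ} (θ : Fin N → Fin N → ℝ) (w₁ w₂ : Fin N → ℝ) : Prop :=
  (∀ i j, 0 ≤ θ i j) ∧ (∀ i, ∑ j, θ i j * w₂ j ≤ 1) ∧ (∀ j, ∑ i, θ i j * w₁ i ≤ 1) ∧
    mass θ w₁ w₂ < 1

/-- Completed step density. -/
noncomputable def rho {N : ℕ} (θ : Fin N → Fin N → ℝ) (w₁ w₂ : Fin N → ℝ) (i j : Fin N) : ℝ :=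
  θ i j + (1 - ∑ j', θ i j' * w₂ j') * (1 - ∑ i', θ i' j * w₁ i') / (1 - mass θ w₁ w₂)

/-- Upper bound for the discretised cost of the completed coupling. -/
noncomputable def dcost {N : ℕ} (C : Fin N → Fin N → ℝ) (D : ℝ)
    (θ : Fin N → Fin N → ℝ) (w₁ w₂ : Fin N → ℝ) : ℝ :=
  (∑ i, ∑ j, θ i j * w₁ i * w₂ j * C i j) + D * (1 - mass θ w₁ w₂)

lemma rho_nonneg {N : ℕ} {θ : Fin N → Fin N → ℝ} {w₁ w₂ : Fin N → ℝ} (h : Feas θ w₁ w₂)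
    (i j : Fin N) : 0 ≤ rho θ w₁ w₂ i j := by
  obtain ⟨h0, h1, h2, h3⟩ := h
  have := h0 i j
  have := h1 i
  have := h2 j
  unfold rho
  have : 0 ≤ (1 - ∑ j', θ i j' * w₂ j') * (1 - ∑ i', θ i' j * w₁ i') / (1 - mass θ w₁ w₂) :=
    div_nonneg (mul_nonneg (by linarith) (by linarith)) (by linarith)
  linarith

lemma sum_a {N : ℕ} (θ : Fin N → Fin N → ℝ) (w₁ w₂ : Fin N → ℝ) (hw₁ : ∑ i, w₁ i = 1) :
    ∑ i, (1 - ∑ j', θ i j' * w₂ j') * w₁ i = 1 - mass θ w₁ w₂ := by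
  simp only [sub_mul, one_mul, Finset.sum_sub_distrib, hw₁, mass, Finset.sum_mul]
  congr 1
  exact Finset.sum_congr rfl fun i _ => Finset.sum_congr rfl fun j _ => by ring

lemma sum_b {N : ℕ} (θ : Fin N → Fin N → ℝ) (w₁ w₂ : Fin N → ℝ) (hw₂ : ∑ i, w₂ i = 1) :
    ∑ j, (1 - ∑ i', θ i' j * w₁ i') * w₂ j = 1 - mass θ w₁ w₂ := by
  simp only [sub_mul, one_mul, Finset.sum_sub_distrib, hw₂, mass, Finset.sum_mul]
  rw [Finset.sum_comm]

lemma rho_row {N : ℕ} {θ : Fin N → Fin N → ℝ} {w₁ w₂ : Fin N → ℝ} (h : Feas θ w₁ w₂)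
    (hw₂ : ∑ i, w₂ i = 1) (i : Fin N) : ∑ j, rho θ w₁ w₂ i j * w₂ j = 1 := by
  have h3 : 1 - mass θ w₁ w₂ ≠ 0 := by have := h.2.2.2; linarith
  have := sum_b θ w₁ w₂ hw₂
  have e : ∀ j, rho θ w₁ w₂ i j * w₂ j = θ i j * w₂ j +
      (1 - ∑ j', θ i j' * w₂ j') / (1 - mass θ w₁ w₂) * ((1 - ∑ i', θ i' j * w₁ i') * w₂ j) := by
    intro j; unfold rho; ring
  simp only [e, Finset.sum_add_distrib, ← Finset.mul_sum, this]
  field_simp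
  ring

lemma rho_col {N : ℕ} {θ : Fin N → Fin N → ℝ} {w₁ w₂ : Fin N → ℝ} (h : Feas θ w₁ w₂)
    (hw₁ : ∑ i, w₁ i = 1) (j : Fin N) : ∑ i, rho θ w₁ w₂ i j * w₁ i = 1 := by
  have h3 : 1 - mass θ w₁ w₂ ≠ 0 := by have := h.2.2.2; linarith
  have := sum_a θ w₁ w₂ hw₁
  have e : ∀ i, rho θ w₁ w₂ i j * w₁ i = θ i j * w₁ i +
      (1 - ∑ i', θ i' j * w₁ i') / (1 - mass θ w₁ w₂) * ((1 - ∑ j', θ i j' * w₂ j') * w₁ i) := by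
    intro i; unfold rho; ring
  simp only [e, Finset.sum_add_distrib, ← Finset.mul_sum, this]
  field_simp
  ring

lemma rho_cost {N : ℕ} {θ : Fin N → Fin N → ℝ} {w₁ w₂ : Fin N → ℝ} (h : Feas θ w₁ w₂)
    (hw₁ : ∑ i, w₁ i = 1) (hw₂ : ∑ i, w₂ i = 1) (h₁ : ∀ i, 0 ≤ w₁ i) (h₂ : ∀ i, 0 ≤ w₂ i)
    {C : Fin N → Fin N → ℝ} {D : ℝ} (hC : ∀ i j, C i j ≤ D) :
    ∑ i, ∑ j, rho θ w₁ w₂ i j * w₁ i * w₂ j * C i j ≤ dcost C D θ w₁ w₂ := by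
  have h3 : 0 < 1 - mass θ w₁ w₂ := by have := h.2.2.2; linarith
  have ea := sum_a θ w₁ w₂ hw₁
  have eb := sum_b θ w₁ w₂ hw₂
  have key : ∀ i j, rho θ w₁ w₂ i j * w₁ i * w₂ j * C i j ≤ θ i j * w₁ i * w₂ j * C i j +
      (((1 - ∑ j', θ i j' * w₂ j') * w₁ i) * ((1 - ∑ i', θ i' j * w₁ i') * w₂ j)) *
        (D / (1 - mass θ w₁ w₂)) := by
    intro i j
    have a0 : 0 ≤ (1 - ∑ j', θ i j' * w₂ j') * w₁ i :=
      mul_nonneg (by linarith [h.2.1 i]) (h₁ i)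
    have b0 : 0 ≤ (1 - ∑ i', θ i' j * w₁ i') * w₂ j :=
      mul_nonneg (by linarith [h.2.2.1 j]) (h₂ j)
    have e : rho θ w₁ w₂ i j * w₁ i * w₂ j * C i j = θ i j * w₁ i * w₂ j * C i j +
      (((1 - ∑ j', θ i j' * w₂ j') * w₁ i) * ((1 - ∑ i', θ i' j * w₁ i') * w₂ j)) *
        (C i j / (1 - mass θ w₁ w₂)) := by unfold rho; ring
    rw [e]
    gcongr
    exact hC i j
  calc _ ≤ _ := Finset.sum_le_sum fun i _ => Finset.sum_le_sum fun j _ => key i j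
    _ = dcost C D θ w₁ w₂ := by
      simp only [Finset.sum_add_distrib, ← Finset.sum_mul, ← Finset.mul_sum, ea, eb]
      unfold dcost
      field_simp

lemma exists_round (x η : ℝ) (hx : 0 ≤ x) (hη : 0 < η) (hη1 : η < 1) :
    ∃ r : ℚ, 0 ≤ (r : ℝ) ∧ (r : ℝ) ≤ (1 - η) * x ∧ (1 - η) * x - η ≤ r := by
  have hy : 0 ≤ (1 - η) * x := mul_nonneg (by linarith) hx
  rcases hy.eq_or_lt with h | h
  · exact ⟨0, by simp, by simp [← h], by simp [← h]; exact hη.le⟩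
  · obtain ⟨r, h1, h2⟩ := exists_rat_btwn (show max 0 ((1 - η) * x - η) < (1 - η) * x from
      max_lt h (by linarith))
    exact ⟨r, (le_max_left _ _).trans h1.le, h2.le, (le_max_right _ _).trans h1.le⟩

/-- Rational sub-couplings approximate a given coupling matrix `g`. -/
lemma exists_theta {N : ℕ} {g : Fin N → Fin N → ℝ} {w₁ w₂ : Fin N → ℝ}
    (hg : ∀ i j, 0 ≤ g i j) (hg₁ : ∀ i, ∑ j, g i j = w₁ i) (hg₂ : ∀ j, ∑ i, g i j = w₂ j)
    (hw₁ : ∑ i, w₁ i = 1) (hw₂ : ∑ i, w₂ i = 1)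
    {C : Fin N → Fin N → ℝ} {D : ℝ} (hC0 : ∀ i j, 0 ≤ C i j) (hD : 0 ≤ D)
    {η : ℝ} (hη : 0 < η) (hη1 : η < 1) :
    ∃ θ : Fin N → Fin N → ℚ, Feas (fun i j => (θ i j : ℝ)) w₁ w₂ ∧
      dcost C D (fun i j => (θ i j : ℝ)) w₁ w₂ ≤ (∑ i, ∑ j, g i j * C i j) + D * (2 * η) := by
  have h₁ : ∀ i, 0 ≤ w₁ i := fun i => hg₁ i ▸ Finset.sum_nonneg fun j _ => hg i j
  have h₂ : ∀ i, 0 ≤ w₂ i := fun i => hg₂ i ▸ Finset.sum_nonneg fun j _ => hg j i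
  have l₁ : ∀ i j, g i j ≤ w₁ i := fun i j => hg₁ i ▸
    Finset.single_le_sum (f := fun j => g i j) (fun j _ => hg i j) (Finset.mem_univ j)
  have l₂ : ∀ i j, g i j ≤ w₂ j := fun i j => hg₂ j ▸
    Finset.single_le_sum (f := fun i => g i j) (fun i _ => hg i j) (Finset.mem_univ i)
  have z₁ : ∀ i j, w₁ i = 0 → g i j = 0 := fun i j h => le_antisymm (h ▸ l₁ i j) (hg i j)
  have z₂ : ∀ i j, w₂ j = 0 → g i j = 0 := fun i j h => le_antisymm (h ▸ l₂ i j) (hg i j)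
  have hx : ∀ i j, 0 ≤ g i j / (w₁ i * w₂ j) := fun i j =>
    div_nonneg (hg i j) (mul_nonneg (h₁ i) (h₂ j))
  have x12 : ∀ i j, g i j / (w₁ i * w₂ j) * w₁ i * w₂ j = g i j := by
    intro i j
    by_cases a : w₁ i = 0
    · simp [a, z₁ i j a]
    by_cases b : w₂ j = 0
    · simp [b, z₂ i j b]
    field_simp
  have x2 : ∀ i j, g i j / (w₁ i * w₂ j) * w₂ j = g i j / w₁ i := by
    intro i j
    by_cases b : w₂ j = 0
    · simp [b, z₂ i j b]
    by_cases a : w₁ i = 0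
    · simp [a]
    field_simp
  have x1 : ∀ i j, g i j / (w₁ i * w₂ j) * w₁ i = g i j / w₂ j := by
    intro i j
    by_cases a : w₁ i = 0
    · simp [a, z₁ i j a]
    by_cases b : w₂ j = 0
    · simp [b]
    field_simp
  choose θ t0 tu tl using fun i j => exists_round _ η (hx i j) hη hη1
  have gs : ∑ i, ∑ j, g i j = 1 := by simp [hg₁, hw₁]
  have ws : ∑ i, ∑ j, w₁ i * w₂ j = 1 := by simp [← Finset.mul_sum, hw₁, hw₂]
  have u12 : ∀ i j, (θ i j : ℝ) * w₁ i * w₂ j ≤ (1 - η) * g i j := by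
    intro i j
    calc (θ i j : ℝ) * w₁ i * w₂ j ≤ ((1 - η) * (g i j / (w₁ i * w₂ j))) * w₁ i * w₂ j := by
          have := h₁ i; have := h₂ j; have := tu i j; gcongr
      _ = (1 - η) * (g i j / (w₁ i * w₂ j) * w₁ i * w₂ j) := by ring
      _ = _ := by rw [x12]
  have d12 : ∀ i j, (1 - η) * g i j - η * (w₁ i * w₂ j) ≤ (θ i j : ℝ) * w₁ i * w₂ j := by
    intro i j
    calc (1 - η) * g i j - η * (w₁ i * w₂ j)
        = (1 - η) * (g i j / (w₁ i * w₂ j) * w₁ i * w₂ j) - η * (w₁ i * w₂ j) := by rw [x12]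
      _ = ((1 - η) * (g i j / (w₁ i * w₂ j)) - η) * w₁ i * w₂ j := by ring
      _ ≤ _ := by
          have := h₁ i; have := h₂ j; have := tl i j; gcongr
  have mu : mass (fun i j => (θ i j : ℝ)) w₁ w₂ ≤ 1 - η := by
    unfold mass
    calc _ ≤ ∑ i, ∑ j, (1 - η) * g i j :=
          Finset.sum_le_sum fun i _ => Finset.sum_le_sum fun j _ => u12 i j
      _ = 1 - η := by simp only [← Finset.mul_sum, gs, mul_one]
  have ml : 1 - 2 * η ≤ mass (fun i j => (θ i j : ℝ)) w₁ w₂ := by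
    unfold mass
    calc 1 - 2 * η = ∑ i, ∑ j, ((1 - η) * g i j - η * (w₁ i * w₂ j)) := by
          simp only [Finset.sum_sub_distrib]
          simp only [← Finset.mul_sum, gs, hw₁, hw₂, ← Finset.sum_mul]; ring
      _ ≤ _ := Finset.sum_le_sum fun i _ => Finset.sum_le_sum fun j _ => d12 i j
  refine ⟨θ, ⟨t0, ?_, ?_, by linarith⟩, ?_⟩
  · intro i
    calc ∑ j, (θ i j : ℝ) * w₂ j ≤ ∑ j, (g i j / (w₁ i * w₂ j)) * w₂ j := by
          refine Finset.sum_le_sum fun j _ => mul_le_mul_of_nonneg_right ?_ (h₂ j)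
          nlinarith [tu i j, hx i j]
      _ = (∑ j, g i j) / w₁ i := by simp only [x2, Finset.sum_div]
      _ ≤ 1 := by rw [hg₁]; exact div_self_le_one _
  · intro j
    calc ∑ i, (θ i j : ℝ) * w₁ i ≤ ∑ i, (g i j / (w₁ i * w₂ j)) * w₁ i := by
          refine Finset.sum_le_sum fun i _ => mul_le_mul_of_nonneg_right ?_ (h₁ i)
          nlinarith [tu i j, hx i j]
      _ = (∑ i, g i j) / w₂ j := by simp only [x1, Finset.sum_div]
      _ ≤ 1 := by rw [hg₂]; exact div_self_le_one _
  · unfold dcost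
    refine add_le_add (Finset.sum_le_sum fun i _ => Finset.sum_le_sum fun j _ => ?_)
      (mul_le_mul_of_nonneg_left (by linarith) hD)
    refine mul_le_mul_of_nonneg_right ((u12 i j).trans ?_) (hC0 i j)
    nlinarith [hg i j]

section Meas

variable {E : Type*} [MeasurableSpace E]

/-- Weights of the cells. -/
noncomputable def wt {N : ℕ} (f : E → Fin N) (q : Measure E) (i : Fin N) : ℝ :=
  q.real (f ⁻¹' {i})

lemma wt_nonneg {N : ℕ} (f : E → Fin N) (q : Measure E) (i : Fin N) : 0 ≤ wt f q i :=
  measureReal_nonneg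

lemma wt_sum {N : ℕ} {f : E → Fin N} (hf : Measurable f) (q : Measure E)
    [IsProbabilityMeasure q] : ∑ i, wt f q i = 1 := by
  unfold wt
  rw [sum_measureReal_preimage_singleton _ (fun y _ => hf (measurableSet_singleton y))]
  simp

lemma lint_step {N : ℕ} {f : E → Fin N} (hf : Measurable f) (q : Measure E)
    [IsProbabilityMeasure q] (G : Fin N → ℝ) (hG : ∀ i, 0 ≤ G i) :
    ∫⁻ u, ENNReal.ofReal (G (f u)) ∂q = ENNReal.ofReal (∑ i, G i * wt f q i) := by
  have : ∫⁻ u, ENNReal.ofReal (G (f u)) ∂q = ∫⁻ i, ENNReal.ofReal (G i) ∂(q.map f) := by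
    rw [lintegral_map (measurable_of_finite _) hf]
  rw [this, lintegral_fintype, ENNReal.ofReal_sum_of_nonneg
    fun i _ => mul_nonneg (hG i) (wt_nonneg f q i)]
  refine Finset.sum_congr rfl fun i _ => ?_
  rw [ENNReal.ofReal_mul (hG i), Measure.map_apply hf (measurableSet_singleton i), wt,
    ofReal_measureReal]

lemma int_step {N : ℕ} {f : E → Fin N} (hf : Measurable f) (μ : Measure (E × E))
    [IsProbabilityMeasure μ] (G : Fin N → Fin N → ℝ) :
    ∫ p, G (f p.1) (f p.2) ∂μ =
      ∑ i, ∑ j, μ.real ((f ⁻¹' {i}) ×ˢ (f ⁻¹' {j})) * G i j := by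
  have hff : Measurable (fun p : E × E => (f p.1, f p.2)) := by fun_prop
  have : ∫ p, G (f p.1) (f p.2) ∂μ =
      ∫ x, G x.1 x.2 ∂(μ.map (fun p : E × E => (f p.1, f p.2))) := by
    rw [integral_map hff.aemeasurable (measurable_of_finite _).aestronglyMeasurable]
  have : IsProbabilityMeasure (μ.map (fun p : E × E => (f p.1, f p.2))) :=
    Measure.isProbabilityMeasure_map hff.aemeasurable
  rw [‹∫ p, G (f p.1) (f p.2) ∂μ = _›, integral_fintype .of_finite, Fintype.sum_prod_type]
  refine Finset.sum_congr rfl fun i _ => Finset.sum_congr rfl fun j _ => ?_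
  rw [map_measureReal_apply hff (measurableSet_singleton _), smul_eq_mul]
  congr 2
  ext p; simp

/-- The coupling with step density. -/
noncomputable def cpl {N : ℕ} (f : E → Fin N) (θ : Fin N → Fin N → ℝ) (q₁ q₂ : Measure E) :
    Measure (E × E) :=
  (q₁.prod q₂).withDensity
    fun p => ENNReal.ofReal (rho θ (wt f q₁) (wt f q₂) (f p.1) (f p.2))

variable {N : ℕ} {f : E → Fin N} {θ : Fin N → Fin N → ℝ} {q₁ q₂ : Measure E}

lemma meas_rho (hf : Measurable f) (R : Fin N → Fin N → ℝ) :
    Measurable fun p : E × E => ENNReal.ofReal (R (f p.1) (f p.2)) := by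
  have : Measurable (fun x : Fin N × Fin N => ENNReal.ofReal (R x.1 x.2)) :=
    measurable_of_finite _
  exact this.comp (g := fun x : Fin N × Fin N => ENNReal.ofReal (R x.1 x.2))
    (f := fun p : E × E => (f p.1, f p.2)) (by fun_prop)

lemma cpl_fst (hf : Measurable f) [IsProbabilityMeasure q₁] [IsProbabilityMeasure q₂]
    (h : Feas θ (wt f q₁) (wt f q₂)) : (cpl f θ q₁ q₂).map Prod.fst = q₁ := by
  ext B hB
  rw [Measure.map_apply measurable_fst hB, cpl, withDensity_apply _ (measurable_fst hB),
    ← Set.prod_univ, setLIntegral_prod _ (meas_rho hf _).aemeasurable]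
  simp only [Measure.restrict_univ]
  have : ∀ u, ∫⁻ v, ENNReal.ofReal (rho θ (wt f q₁) (wt f q₂) (f u) (f v)) ∂q₂ = 1 := by
    intro u
    rw [lint_step hf q₂ _ (fun j => rho_nonneg h (f u) j), rho_row h (wt_sum hf q₂)]
    simp
  simp [this]

lemma cpl_snd (hf : Measurable f) [IsProbabilityMeasure q₁] [IsProbabilityMeasure q₂]
    (h : Feas θ (wt f q₁) (wt f q₂)) : (cpl f θ q₁ q₂).map Prod.snd = q₂ := by
  ext B hB
  rw [Measure.map_apply measurable_snd hB, cpl, withDensity_apply _ (measurable_snd hB),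
    ← Set.univ_prod, setLIntegral_prod_symm _ (meas_rho hf _).aemeasurable]
  simp only [Measure.restrict_univ]
  have : ∀ v, ∫⁻ u, ENNReal.ofReal (rho θ (wt f q₁) (wt f q₂) (f u) (f v)) ∂q₁ = 1 := by
    intro v
    rw [lint_step hf q₁ (fun i => rho θ (wt f q₁) (wt f q₂) i (f v)) (fun j => rho_nonneg h j (f v)),
      rho_col h (wt_sum hf q₁)]
    simp
  simp [this]

lemma prob_of_fst {F : Type*} [MeasurableSpace F] {μ : Measure (E × F)} {q : Measure E} [IsProbabilityMeasure q]
    (h : μ.map Prod.fst = q) : IsProbabilityMeasure μ := by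
  constructor
  have : q Set.univ = 1 := measure_univ
  rw [← h, Measure.map_apply measurable_fst .univ] at this
  simpa using this

lemma cpl_cell (hf : Measurable f) [IsProbabilityMeasure q₁] [IsProbabilityMeasure q₂]
    (h : Feas θ (wt f q₁) (wt f q₂)) (i j : Fin N) :
    (cpl f θ q₁ q₂).real ((f ⁻¹' {i}) ×ˢ (f ⁻¹' {j})) =
      rho θ (wt f q₁) (wt f q₂) i j * wt f q₁ i * wt f q₂ j := by
  have hi : MeasurableSet (f ⁻¹' {i}) := hf (measurableSet_singleton i)
  have hj : MeasurableSet (f ⁻¹' {j}) := hf (measurableSet_singleton j)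
  have : (cpl f θ q₁ q₂) ((f ⁻¹' {i}) ×ˢ (f ⁻¹' {j})) =
      ENNReal.ofReal (rho θ (wt f q₁) (wt f q₂) i j) * (q₁ (f ⁻¹' {i}) * q₂ (f ⁻¹' {j})) := by
    rw [cpl, withDensity_apply _ (hi.prod hj), ← Measure.prod_prod, ← setLIntegral_const]
    refine setLIntegral_congr_fun (hi.prod hj) fun p hp => ?_
    obtain ⟨h1, h2⟩ := hp
    simp only [Set.mem_preimage, Set.mem_singleton_iff] at h1 h2
    simp only [h1, h2]
  rw [Measure.real, this, ENNReal.toReal_mul, ENNReal.toReal_mul,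
    ENNReal.toReal_ofReal (rho_nonneg h i j)]
  simp only [wt, Measure.real]; ring

variable {c : E → E → ℝ} {C : Fin N → Fin N → ℝ} {D ε : ℝ}

lemma cpl_cost (hf : Measurable f) [IsProbabilityMeasure q₁] [IsProbabilityMeasure q₂]
    (h : Feas θ (wt f q₁) (wt f q₂)) (hc0 : ∀ u v, 0 ≤ c u v)
    (hC : ∀ i j, C i j ≤ D) (hcC : ∀ u v, |c u v - C (f u) (f v)| ≤ ε) :
    ∫ p, c p.1 p.2 ∂(cpl f θ q₁ q₂) ≤ dcost C D θ (wt f q₁) (wt f q₂) + ε := by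
  have hp : IsProbabilityMeasure (cpl f θ q₁ q₂) := prob_of_fst (cpl_fst hf h)
  have := int_step hf (cpl f θ q₁ q₂) (fun i j => C i j + ε)
  have hm : Measurable (fun p : E × E => C (f p.1) (f p.2)) :=
    (measurable_of_finite (fun x : Fin N × Fin N => C x.1 x.2)).comp
      (f := fun p : E × E => (f p.1, f p.2)) (by fun_prop)
  have hi : Integrable (fun p : E × E => C (f p.1) (f p.2)) (cpl f θ q₁ q₂) := by
    refine .of_bound hm.aestronglyMeasurable (∑ i, ∑ j, |C i j|) (.of_forall fun p => ?_)
    rw [Real.norm_eq_abs]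
    exact (Finset.single_le_sum (f := fun j => |C (f p.1) j|) (fun _ _ => abs_nonneg _)
      (Finset.mem_univ (f p.2))).trans (Finset.single_le_sum (f := fun i => ∑ j, |C i j|)
        (fun _ _ => Finset.sum_nonneg fun _ _ => abs_nonneg _) (Finset.mem_univ (f p.1)))
  calc ∫ p, c p.1 p.2 ∂(cpl f θ q₁ q₂) ≤ ∫ p, (C (f p.1) (f p.2) + ε) ∂(cpl f θ q₁ q₂) := by
        refine integral_mono_of_nonneg (.of_forall fun p => hc0 _ _)
          (hi.add (integrable_const _)) (.of_forall fun p => ?_)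
        have := (abs_le.1 (hcC p.1 p.2)).2
        simp only; linarith
    _ = ∫ p, C (f p.1) (f p.2) ∂(cpl f θ q₁ q₂) + ε := by
        rw [integral_add hi (integrable_const _)]; simp
    _ ≤ _ := by
        rw [int_step hf]
        simp only [cpl_cell hf h]
        gcongr
        exact rho_cost h (wt_sum hf q₁) (wt_sum hf q₂) (wt_nonneg f q₁) (wt_nonneg f q₂) hC

lemma exists_theta_cpl (hf : Measurable f) [IsProbabilityMeasure q₁] [IsProbabilityMeasure q₂]
    (hcm : Measurable fun p : E × E => c p.1 p.2) (hc0 : ∀ u v, 0 ≤ c u v)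
    (hcD : ∀ u v, c u v ≤ D)
    (hC0 : ∀ i j, 0 ≤ C i j) (hD : 0 ≤ D) (hcC : ∀ u v, |c u v - C (f u) (f v)| ≤ ε)
    {γ : Measure (E × E)} (hγ₁ : γ.map Prod.fst = q₁) (hγ₂ : γ.map Prod.snd = q₂)
    {η : ℝ} (hη : 0 < η) (hη1 : η < 1) :
    ∃ θ : Fin N → Fin N → ℚ, Feas (fun i j => (θ i j : ℝ)) (wt f q₁) (wt f q₂) ∧
      dcost C D (fun i j => (θ i j : ℝ)) (wt f q₁) (wt f q₂) ≤
        ∫ p, c p.1 p.2 ∂γ + ε + D * (2 * η) := by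
  have hp : IsProbabilityMeasure γ := prob_of_fst hγ₁
  have hs : ∀ i, MeasurableSet (f ⁻¹' {i}) := fun i => hf (measurableSet_singleton i)
  have hR : ∀ i, ∑ j, γ.real ((f ⁻¹' {i}) ×ˢ (f ⁻¹' {j})) = wt f q₁ i := by
    intro i
    have e : ∀ j, (f ⁻¹' {i}) ×ˢ (f ⁻¹' {j}) =
      (fun p : E × E => f p.2) ⁻¹' {j} ∩ Prod.fst ⁻¹' (f ⁻¹' {i}) := by
      intro j; ext p; simp [and_comm]
    have hm : Measurable (fun p : E × E => f p.2) := by fun_prop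
    rw [wt, ← hγ₁, map_measureReal_apply measurable_fst (hs i)]
    simp only [e]
    have : ∀ j, γ.real ((fun p : E × E => f p.2) ⁻¹' {j} ∩ Prod.fst ⁻¹' (f ⁻¹' {i})) =
        wt (fun p : E × E => f p.2) (γ.restrict (Prod.fst ⁻¹' (f ⁻¹' {i}))) j := by
      intro j
      rw [wt, measureReal_restrict_apply (hm (measurableSet_singleton j))]
    simp only [this, wt]
    rw [sum_measureReal_preimage_singleton _ (fun y _ => hm (measurableSet_singleton y))]
    simp
  have hL : ∀ j, ∑ i, γ.real ((f ⁻¹' {i}) ×ˢ (f ⁻¹' {j})) = wt f q₂ j := by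
    intro j
    have e : ∀ i, (f ⁻¹' {i}) ×ˢ (f ⁻¹' {j}) =
      (fun p : E × E => f p.1) ⁻¹' {i} ∩ Prod.snd ⁻¹' (f ⁻¹' {j}) := by
      intro i; ext p; simp
    have hm : Measurable (fun p : E × E => f p.1) := by fun_prop
    rw [wt, ← hγ₂, map_measureReal_apply measurable_snd (hs j)]
    simp only [e]
    have : ∀ i, γ.real ((fun p : E × E => f p.1) ⁻¹' {i} ∩ Prod.snd ⁻¹' (f ⁻¹' {j})) =
        wt (fun p : E × E => f p.1) (γ.restrict (Prod.snd ⁻¹' (f ⁻¹' {j}))) i := by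
      intro i
      rw [wt, measureReal_restrict_apply (hm (measurableSet_singleton i))]
    simp only [this, wt]
    rw [sum_measureReal_preimage_singleton _ (fun y _ => hm (measurableSet_singleton y))]
    simp
  obtain ⟨θ, h1, h2⟩ := exists_theta (g := fun i j => γ.real ((f ⁻¹' {i}) ×ˢ (f ⁻¹' {j})))
    (w₁ := wt f q₁) (w₂ := wt f q₂) (C := C) (D := D) (η := η)
    (fun i j => measureReal_nonneg) hR hL (wt_sum hf q₁) (wt_sum hf q₂) hC0 hD hη hη1
  · refine ⟨θ, h1, h2.trans ?_⟩
    rw [← int_step hf γ]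
    gcongr
    have hi : Integrable (fun p : E × E => c p.1 p.2) γ := by
      refine .of_bound hcm.aestronglyMeasurable D (.of_forall fun p => ?_)
      rw [Real.norm_eq_abs, abs_of_nonneg (hc0 _ _)]
      exact hcD _ _
    calc ∫ p, C (f p.1) (f p.2) ∂γ ≤ ∫ p, (c p.1 p.2 + ε) ∂γ := by
          refine integral_mono_of_nonneg (.of_forall fun p => hC0 _ _)
            (hi.add (integrable_const _)) (.of_forall fun p => ?_)
          have := (abs_le.1 (hcC p.1 p.2)).1
          simp only; linarith
      _ = _ := by rw [integral_add hi (integrable_const _)]; simp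

lemma W2sq_bdd {F : Type*} [MeasurableSpace F] {c : F → F → ℝ} (hc0 : ∀ u v, 0 ≤ c u v) (q₁ q₂ : Measure F) :
    BddBelow {r : ℝ | ∃ π : Measure (F × F),
      π.map Prod.fst = q₁ ∧ π.map Prod.snd = q₂ ∧ r = ∫ p, c p.1 p.2 ∂π} :=
  ⟨0, by rintro _ ⟨π, -, -, rfl⟩; exact integral_nonneg fun p => hc0 _ _⟩

lemma W2sq_nonempty {F : Type*} [MeasurableSpace F] (c : F → F → ℝ) (q₁ q₂ : Measure F)
    [IsProbabilityMeasure q₁] [IsProbabilityMeasure q₂] :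
    {r : ℝ | ∃ π : Measure (F × F),
      π.map Prod.fst = q₁ ∧ π.map Prod.snd = q₂ ∧ r = ∫ p, c p.1 p.2 ∂π}.Nonempty :=
  ⟨_, q₁.prod q₂, by simp [Measure.map_fst_prod], by simp [Measure.map_snd_prod], rfl⟩

/-- Measurable selection of near-optimal couplings, given a fine discretisation. -/
lemma exists_kernel_of_step {S : Type*} [MeasurableSpace S] (κ₁ κ₂ : Kernel S E)
    [IsMarkovKernel κ₁] [IsMarkovKernel κ₂] (hf : Measurable f)
    (hcm : Measurable fun p : E × E => c p.1 p.2) (hc0 : ∀ u v, 0 ≤ c u v)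
    (hcD : ∀ u v, c u v ≤ D)
    (hC0 : ∀ i j, 0 ≤ C i j) (hC : ∀ i j, C i j ≤ D) (hD : 0 ≤ D)
    (hcC : ∀ u v, |c u v - C (f u) (f v)| ≤ ε) (hε : 0 < ε) :
    ∃ K : Kernel S (E × E), IsMarkovKernel K ∧ (∀ s, (K s).map Prod.fst = κ₁ s) ∧
      (∀ s, (K s).map Prod.snd = κ₂ s) ∧
      ∀ s, ∫ p, c p.1 p.2 ∂(K s) ≤ W2sq c (κ₁ s) (κ₂ s) + 5 * ε := by
  classical
  obtain ⟨e, he⟩ := exists_surjective_nat (Fin N → Fin N → ℚ)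
  let T : ℕ → Fin N → Fin N → ℝ := fun k i j => (e k i j : ℝ)
  let w₁ : S → Fin N → ℝ := fun s => wt f (κ₁ s)
  let w₂ : S → Fin N → ℝ := fun s => wt f (κ₂ s)
  have hw₁ : ∀ i, Measurable fun s => w₁ s i := fun i =>
    (κ₁.measurable_coe (hf (measurableSet_singleton i))).ennreal_toReal
  have hw₂ : ∀ i, Measurable fun s => w₂ s i := fun i =>
    (κ₂.measurable_coe (hf (measurableSet_singleton i))).ennreal_toReal
  have hmass : ∀ k, Measurable fun s => mass (T k) (w₁ s) (w₂ s) := by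
    intro k; unfold mass; fun_prop
  have hcost : ∀ k, Measurable fun s => dcost C D (T k) (w₁ s) (w₂ s) := by
    intro k; unfold dcost; have := hmass k; fun_prop
  have hfeas : ∀ k, MeasurableSet {s | Feas (T k) (w₁ s) (w₂ s)} := by
    intro k
    unfold Feas
    refine .inter (.const _) (.inter ?_ (.inter ?_ ?_))
    · exact measurableSet_setOfPred.2 (Measurable.forall fun i => measurableSet_setOfPred.1
        (measurableSet_le (by fun_prop) (by fun_prop)))
    · exact measurableSet_setOfPred.2 (Measurable.forall fun i => measurableSet_setOfPred.1
        (measurableSet_le (by fun_prop) (by fun_prop)))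
    · exact measurableSet_lt (hmass k) (by fun_prop)
  let P : S → ℕ → Prop := fun s k => Feas (T k) (w₁ s) (w₂ s) ∧
    ∀ k', Feas (T k') (w₁ s) (w₂ s) →
      dcost C D (T k) (w₁ s) (w₂ s) ≤ dcost C D (T k') (w₁ s) (w₂ s) + ε
  have hPm : ∀ k, MeasurableSet {s | P s k} := by
    intro k
    refine .inter (hfeas k) (measurableSet_setOfPred.2 (Measurable.forall fun k' =>
      Measurable.imp (measurableSet_setOfPred.1 (hfeas k')) (measurableSet_setOfPred.1
        (measurableSet_le (hcost k) ((hcost k').add_const _)))))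
  have hcost0 : ∀ s k, Feas (T k) (w₁ s) (w₂ s) → 0 ≤ dcost C D (T k) (w₁ s) (w₂ s) := by
    intro s k h
    refine le_trans ?_ (rho_cost h (wt_sum hf (κ₁ s)) (wt_sum hf (κ₂ s)) (wt_nonneg f _)
      (wt_nonneg f _) hC)
    exact Finset.sum_nonneg fun i _ => Finset.sum_nonneg fun j _ =>
      mul_nonneg (mul_nonneg (mul_nonneg (rho_nonneg h i j) (wt_nonneg f _ _))
        (wt_nonneg f _ _)) (hC0 i j)
  -- near optimal among couplings
  have happ : ∀ s, ∃ k, Feas (T k) (w₁ s) (w₂ s) ∧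
      dcost C D (T k) (w₁ s) (w₂ s) ≤ W2sq c (κ₁ s) (κ₂ s) + 3 * ε := by
    intro s
    obtain ⟨_, ⟨γ, hγ₁, hγ₂, rfl⟩, hγ⟩ := exists_lt_of_csInf_lt (W2sq_nonempty c (κ₁ s) (κ₂ s))
      (show W2sq c (κ₁ s) (κ₂ s) < W2sq c (κ₁ s) (κ₂ s) + ε by linarith)
    have hη : 0 < min (1/2) (ε / (2 * (D + 1))) := by positivity
    obtain ⟨θ, h1, h2⟩ := exists_theta_cpl hf hcm hc0 hcD hC0 hD hcC hγ₁ hγ₂ hη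
      (lt_of_le_of_lt (min_le_left _ _) (by norm_num))
    obtain ⟨k, rfl⟩ := he θ
    refine ⟨k, h1, h2.trans ?_⟩
    have : D * (2 * min (1/2) (ε / (2 * (D + 1)))) ≤ ε := by
      calc D * (2 * min (1/2) (ε / (2 * (D + 1)))) ≤ D * (2 * (ε / (2 * (D + 1)))) := by
            gcongr; exact min_le_right _ _
        _ = ε * (D / (D + 1)) := by field_simp
        _ ≤ ε * 1 := by gcongr; exact (div_le_one (by linarith)).2 (by linarith)
        _ = ε := mul_one _
    linarith
  have hP : ∀ s, ∃ k, P s k := by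
    intro s
    let A : Set ℝ := {r | ∃ k, Feas (T k) (w₁ s) (w₂ s) ∧ r = dcost C D (T k) (w₁ s) (w₂ s)}
    have hA : A.Nonempty := by obtain ⟨k, hk, -⟩ := happ s; exact ⟨_, k, hk, rfl⟩
    have hb : BddBelow A := ⟨0, by rintro _ ⟨k, hk, rfl⟩; exact hcost0 s k hk⟩
    obtain ⟨_, ⟨k, hk, rfl⟩, hlt⟩ := exists_lt_of_csInf_lt hA
      (show sInf A < sInf A + ε by linarith)
    refine ⟨k, hk, fun k' hk' => ?_⟩
    have := csInf_le hb ⟨k', hk', rfl⟩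
    linarith
  let sel : S → ℕ := fun s => Nat.find (hP s)
  have hsel : Measurable sel := measurable_find hP hPm
  have hspec : ∀ s, P s (sel s) := fun s => Nat.find_spec (hP s)
  let dens : S → E × E → ENNReal := fun s p =>
    ENNReal.ofReal (rho (T (sel s)) (w₁ s) (w₂ s) (f p.1) (f p.2))
  have hdens : Measurable (Function.uncurry dens) := by
    have h1 : Measurable (fun x : (ℕ × Fin N × Fin N) × S =>
        ENNReal.ofReal (rho (T x.1.1) (w₁ x.2) (w₂ x.2) x.1.2.1 x.1.2.2)) := by
      refine measurable_from_prod_countable_right fun ⟨k, i, j⟩ => ?_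
      have := hmass k
      simp only [rho]
      fun_prop
    exact h1.comp (f := fun x : S × (E × E) => ((sel x.1, f x.2.1, f x.2.2), x.1)) (by fun_prop)
  have hK : ∀ s, ((κ₁ ×ₖ κ₂).withDensity dens) s = cpl f (T (sel s)) (κ₁ s) (κ₂ s) := by
    intro s
    rw [Kernel.withDensity_apply _ hdens, Kernel.prod_apply]
    rfl
  refine ⟨(κ₁ ×ₖ κ₂).withDensity dens, ⟨fun s => ?_⟩, fun s => ?_, fun s => ?_, fun s => ?_⟩
  · rw [hK]; exact prob_of_fst (cpl_fst hf (hspec s).1)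
  · rw [hK]; exact cpl_fst hf (hspec s).1
  · rw [hK]; exact cpl_snd hf (hspec s).1
  · rw [hK]
    have := cpl_cost hf (hspec s).1 hc0 hC hcC
    obtain ⟨k, hk, hk'⟩ := happ s
    have := (hspec s).2 k hk
    linarith

end Meas

lemma W2sq_le_int {F : Type*} [MeasurableSpace F] {c : F → F → ℝ} (hc0 : ∀ u v, 0 ≤ c u v)
    {q₁ q₂ : Measure F} {π : Measure (F × F)} (h₁ : π.map Prod.fst = q₁)
    (h₂ : π.map Prod.snd = q₂) : W2sq c q₁ q₂ ≤ ∫ p, c p.1 p.2 ∂π :=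
  csInf_le (W2sq_bdd hc0 q₁ q₂) ⟨π, h₁, h₂, rfl⟩

lemma int_poly {F : Type*} [MeasurableSpace F] (k : Measure F) [IsProbabilityMeasure k]
    (X : F → ℝ) (i1 : Integrable X k) (i2 : Integrable (fun p => X p ^ 2) k) (a b : ℝ) :
    ∫ p, (a + b * X p + X p ^ 2) ∂k = a + b * (∫ p, X p ∂k) + ∫ p, X p ^ 2 ∂k := by
  have i3 : Integrable (fun p => b * X p) k := i1.const_mul b
  have i4 : Integrable (fun p => a + b * X p) k := (integrable_const a).add i3
  rw [integral_add i4 i2, integral_add (integrable_const a) i3, integral_const_mul]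
  simp

section Metric

variable {E : Type*} [MetricSpace E] [CompactSpace E] [MeasurableSpace E] [BorelSpace E]

lemma exists_step [Nonempty E] {R : ℝ} (hR0 : 0 ≤ R) (hR : ∀ u v : E, dist u v ≤ R)
    {ε : ℝ} (hε : 0 < ε) :
    ∃ (N : ℕ) (f : E → Fin N) (C : Fin N → Fin N → ℝ), Measurable f ∧ (∀ i j, 0 ≤ C i j) ∧
      (∀ i j, C i j ≤ R ^ 2) ∧ ∀ u v, |dist u v ^ 2 - C (f u) (f v)| ≤ ε := by
  classical
  let δ : ℝ := ε / (4 * (R + 1))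
  have hδ : 0 < δ := by positivity
  let a : ℕ → E := TopologicalSpace.denseSeq E
  have ha : ∀ u : E, ∃ k, dist u (a k) < δ := fun u => by
    obtain ⟨k, hk⟩ := (TopologicalSpace.denseRange_denseSeq E).exists_dist_lt u hδ
    exact ⟨k, hk⟩
  obtain ⟨t, ht⟩ := isCompact_univ.elim_finite_subcover (fun k => Metric.ball (a k) δ)
    (fun k => Metric.isOpen_ball) (fun u _ => by
      obtain ⟨k, hk⟩ := ha u; exact Set.mem_iUnion.2 ⟨k, hk⟩)
  let g : E → ℕ := fun u => Nat.find (ha u)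
  have hg : Measurable g := measurable_find ha fun k =>
    measurableSet_lt (by fun_prop) (by fun_prop)
  have hgN : ∀ u, g u < t.sup id + 1 := by
    intro u
    obtain ⟨k, hk, hku⟩ := Set.mem_iUnion₂.1 (ht (Set.mem_univ u))
    have h1 : g u ≤ k := Nat.find_min' (ha u) hku
    have h2 : k ≤ t.sup id := Finset.le_sup (f := id) hk
    omega
  refine ⟨t.sup id + 1, fun u => ⟨g u, hgN u⟩, fun i j => dist (a i) (a j) ^ 2, ?_,
    fun i j => by positivity, fun i j => pow_le_pow_left₀ dist_nonneg (hR _ _) 2, fun u v => ?_⟩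
  · refine measurable_to_countable' fun i => ?_
    have : (fun u => (⟨g u, hgN u⟩ : Fin (t.sup id + 1))) ⁻¹' {i} = g ⁻¹' {(i : ℕ)} := by
      ext u; simp [Fin.ext_iff]
    rw [this]; exact hg (measurableSet_singleton _)
  · have h1 : dist u (a (g u)) < δ := Nat.find_spec (ha u)
    have h2 : dist v (a (g v)) < δ := Nat.find_spec (ha v)
    have h3 := dist_dist_dist_le u v (a (g u)) (a (g v))
    rw [Real.dist_eq] at h3
    have h4 := hR u v
    have h5 := hR (a (g u)) (a (g v))
    have e : dist u v ^ 2 - dist (a (g u)) (a (g v)) ^ 2 =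
      (dist u v - dist (a (g u)) (a (g v))) * (dist u v + dist (a (g u)) (a (g v))) := by ring
    simp only
    rw [e, abs_mul, abs_of_nonneg (a := dist u v + dist (a (g u)) (a (g v))) (by positivity)]
    calc _ ≤ (2 * δ) * (2 * (R + 1)) := by
          gcongr
          · linarith
          · linarith
      _ = ε := by simp only [δ]; field_simp; norm_num

lemma exists_kernel [Nonempty E] {R : ℝ} (hR0 : 0 ≤ R) (hR : ∀ u v : E, dist u v ≤ R)
    {S : Type*} [MeasurableSpace S] (κ₁ κ₂ : Kernel S E)
    [IsMarkovKernel κ₁] [IsMarkovKernel κ₂] {ε : ℝ} (hε : 0 < ε) :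
    ∃ K : Kernel S (E × E), IsMarkovKernel K ∧ (∀ s, (K s).map Prod.fst = κ₁ s) ∧
      (∀ s, (K s).map Prod.snd = κ₂ s) ∧
      ∀ s, ∫ p, dist p.1 p.2 ^ 2 ∂(K s) ≤
        W2sq (fun u v : E => dist u v ^ 2) (κ₁ s) (κ₂ s) + ε := by
  obtain ⟨N, f, C, hf, hC0, hC, hcC⟩ := exists_step hR0 hR (show 0 < ε / 5 by positivity)
  obtain ⟨K, h1, h2, h3, h4⟩ := exists_kernel_of_step (c := fun u v : E => dist u v ^ 2)
    (D := R ^ 2) κ₁ κ₂ hf (by fun_prop) (fun u v => by positivity)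
    (fun u v => by have := hR u v; gcongr) hC0 hC (by positivity) hcC (by positivity)
  refine ⟨K, h1, h2, h3, fun s => (h4 s).trans (le_of_eq (by ring))⟩

lemma W2sq_meas [Nonempty E] {S : Type*} [MeasurableSpace S] (κ₁ κ₂ : Kernel S E)
    [IsMarkovKernel κ₁] [IsMarkovKernel κ₂] :
    Measurable fun s => W2sq (fun u v : E => dist u v ^ 2) (κ₁ s) (κ₂ s) := by
  have hR : ∀ u v : E, dist u v ≤ Metric.diam (Set.univ : Set E) := fun u v =>
    Metric.dist_le_diam_of_mem isCompact_univ.isBounded (Set.mem_univ _) (Set.mem_univ _)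
  choose K h1 h2 h3 h4 using fun n : ℕ => exists_kernel Metric.diam_nonneg hR κ₁ κ₂
    (show (0 : ℝ) < 1 / ((n : ℝ) + 1) by positivity)
  refine measurable_of_tendsto_metrizable (f := fun n s => ∫ p, dist p.1 p.2 ^ 2 ∂(K n s))
    (fun n => ?_) (tendsto_pi_nhds.2 fun s => ?_)
  · have : StronglyMeasurable (fun p : E × E => dist p.1 p.2 ^ 2) :=
      (by fun_prop : Measurable (fun p : E × E => dist p.1 p.2 ^ 2)).stronglyMeasurable
    exact this.integral_kernel.measurable
  · refine tendsto_of_tendsto_of_tendsto_of_le_of_le tendsto_const_nhds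
      (h := fun n : ℕ => W2sq (fun u v : E => dist u v ^ 2) (κ₁ s) (κ₂ s) + 1 / ((n : ℝ) + 1))
      ?_ (fun n => ?_) (fun n => h4 n s)
    · simpa using tendsto_const_nhds.add (tendsto_one_div_add_atTop_nhds_zero_nat (𝕜 := ℝ))
    · exact W2sq_le_int (c := fun u v : E => dist u v ^ 2) (fun u v => sq_nonneg _) (h2 n s) (h3 n s)

lemma W2sq_nonneg (q₁ q₂ : Measure E) : 0 ≤ W2sq (fun u v : E => dist u v ^ 2) q₁ q₂ := by
  refine Real.sInf_nonneg ?_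
  rintro _ ⟨π, -, -, rfl⟩; exact integral_nonneg fun p => by positivity

lemma W2sq_le {R : ℝ} (hR : ∀ u v : E, dist u v ≤ R)
    (q₁ q₂ : Measure E) [IsProbabilityMeasure q₁] [IsProbabilityMeasure q₂] :
    W2sq (fun u v : E => dist u v ^ 2) q₁ q₂ ≤ R ^ 2 := by
  refine (W2sq_le_int (c := fun u v : E => dist u v ^ 2) (π := q₁.prod q₂)
    (fun u v => sq_nonneg _)
    (by simp [Measure.map_fst_prod]) (by simp [Measure.map_snd_prod])).trans ?_
  calc ∫ p, dist p.1 p.2 ^ 2 ∂(q₁.prod q₂) ≤ ∫ _p, R ^ 2 ∂(q₁.prod q₂) := by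
        refine integral_mono_of_nonneg (.of_forall fun p => by positivity) (integrable_const _)
          (.of_forall fun p => ?_)
        have := hR p.1 p.2
        simp only; gcongr
    _ = R ^ 2 := by simp

/-- The inner integral estimate. -/
lemma inner_est {R : ℝ} (hR : ∀ u v : E, dist u v ≤ R) (k : Measure (E × E))
    [IsProbabilityMeasure k] {r W η : ℝ} (hr : 0 ≤ r) (hW : 0 ≤ W) (hη : 0 < η)
    (h : ∫ p, dist p.1 p.2 ^ 2 ∂k ≤ W ^ 2 + η ^ 2) :
    ∫ p, (r + dist p.1 p.2) ^ 2 ∂k ≤ (r + W) ^ 2 + η * (2 * r + η) := by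
  have hm : Measurable (fun p : E × E => dist p.1 p.2) := by fun_prop
  have i1 : Integrable (fun p : E × E => dist p.1 p.2) k :=
    .of_bound hm.aestronglyMeasurable R (.of_forall fun p => by
      rw [Real.norm_eq_abs, abs_of_nonneg dist_nonneg]; exact hR _ _)
  have i2 : Integrable (fun p : E × E => dist p.1 p.2 ^ 2) k :=
    .of_bound (hm.pow_const 2).aestronglyMeasurable (R ^ 2) (.of_forall fun p => by
      rw [Real.norm_eq_abs, abs_of_nonneg (by positivity)]; have := hR p.1 p.2; gcongr)
  set m := ∫ p, dist p.1 p.2 ∂k with hmdef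
  set v := ∫ p, dist p.1 p.2 ^ 2 ∂k with hvdef
  have hm0 : 0 ≤ m := integral_nonneg fun p => dist_nonneg
  have hmv : m ^ 2 ≤ v := by
    have : 0 ≤ ∫ p, (dist p.1 p.2 - m) ^ 2 ∂k := integral_nonneg fun p => by positivity
    have e : ∫ p, (dist p.1 p.2 - m) ^ 2 ∂k = v - 2 * m * m + m ^ 2 := by
      have : ∀ p : E × E, (dist p.1 p.2 - m) ^ 2 =
        m ^ 2 + (- (2 * m)) * dist p.1 p.2 + dist p.1 p.2 ^ 2 := fun p => by ring
      simp only [this]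
      rw [int_poly k _ i1 i2]
      ring
    nlinarith
  have hmW : m ≤ W + η := by
    refine le_of_sq_le_sq ?_ (by positivity)
    nlinarith [mul_nonneg hW hη.le]
  have e : ∫ p, (r + dist p.1 p.2) ^ 2 ∂k = r ^ 2 + 2 * r * m + v := by
    have : ∀ p : E × E, (r + dist p.1 p.2) ^ 2 =
      r ^ 2 + (2 * r) * dist p.1 p.2 + dist p.1 p.2 ^ 2 := fun p => by ring
    simp only [this]
    rw [int_poly k _ i1 i2]
  rw [e]
  nlinarith [mul_le_mul_of_nonneg_left hmW hr]

end Metric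

lemma prob_set_meas {E : Type*} [MeasurableSpace E] :
    MeasurableSet {q : Measure E | IsProbabilityMeasure q} := by
  have : {q : Measure E | IsProbabilityMeasure q} = (fun q : Measure E => q Set.univ) ⁻¹' {1} := by
    ext q; exact ⟨fun h => h.1, fun h => ⟨h⟩⟩
  rw [this]
  exact Measure.measurable_coe .univ (measurableSet_singleton _)

open Classical in
/-- A Markov kernel which is the identity on probability measures. -/
noncomputable def idk {E : Type*} [MeasurableSpace E] (u : E) : Kernel (Measure E) E where
  toFun q := if IsProbabilityMeasure q then q else Measure.dirac u
  measurable' := Measurable.ite prob_set_meas measurable_id measurable_const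

lemma idk_apply {E : Type*} [MeasurableSpace E] (u : E) (q : Measure E) [h : IsProbabilityMeasure q] :
    idk u q = q := if_pos h

instance {E : Type*} [MeasurableSpace E] (u : E) : IsMarkovKernel (idk u) := ⟨fun q => by
  by_cases h : IsProbabilityMeasure q
  · rw [idk_apply]; exact h
  · have : idk u q = Measure.dirac u := if_neg h
    rw [this]; infer_instance⟩

/-- Marginals of the glued measure. -/
lemma marg {l : ℕ} (U : Set (EuclideanSpace ℝ (Fin l))) {S : Type*} [MeasurableSpace S]
    (ξ : Measure (ℝ × Measure U)) (hae : ∀ᵐ p ∂ξ, IsProbabilityMeasure p.2) (u₀ : U)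
    (π : Measure S) [IsProbabilityMeasure π] (g : S → ℝ × Measure U) (hg : Measurable g)
    (hπ : π.map g = ξ) {F : Type*} [MeasurableSpace F]
    (K : Kernel S F) [IsMarkovKernel K] (pr : F → U) (hpr : Measurable pr)
    (hK : ∀ s, (K s).map pr = idk u₀ (g s).2) :
    (π ⊗ₘ K).map (fun x => ((g x.1).1, pr x.2)) = Pext U ξ := by
  let J : Kernel (ℝ × Measure U) (ℝ × U) :=
    (Kernel.deterministic Prod.fst measurable_fst) ×ₖ ((idk u₀).comap Prod.snd measurable_snd)
  have hJ : ∀ p, J p = (Measure.dirac p.1).prod (idk u₀ p.2) := fun p => by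
    simp only [J, Kernel.prod_apply, Kernel.deterministic_apply, Kernel.comap_apply]
  have h1 : Pext U ξ = ξ.bind J := by
    refine Measure.bind_congr_right ?_
    filter_upwards [hae] with p hp
    rw [hJ, idk_apply]
  rw [h1]
  ext B hB
  have hm : Measurable (fun x : S × F => ((g x.1).1, pr x.2)) := by fun_prop
  rw [Measure.bind_apply hB J.measurable.aemeasurable, ← hπ,
    lintegral_map (J.measurable_coe hB) hg, Measure.map_apply hm hB,
    Measure.compProd_apply (hm hB)]
  refine lintegral_congr fun s => ?_
  rw [hJ, Measure.dirac_prod, Measure.map_apply measurable_prodMk_left hB, ← hK,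
    Measure.map_apply hpr (measurable_prodMk_left hB)]
  rfl

end Stmt4Aux

/-- The map `ξ ↦ 𝒫(ξ)` is 1-Lipschitz from `𝒫₂(ℝ × 𝒫(U))` (metric
`|x₁ - x₂| + W_{2,U}(q₁, q₂)`) to `𝒫₂(ℝ × U)` (metric `|x₁ - x₂| + |u₁ - u₂|`):
`W_{2,ℝ×U}(𝒫(ξ₁), 𝒫(ξ₂)) ≤ W_{2,ℝ×𝒫(U)}(ξ₁, ξ₂)`. -/
theorem stmt4 {l : ℕ} (U : Set (EuclideanSpace ℝ (Fin l))) (hU : IsCompact U)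
    (ξ₁ ξ₂ : Measure (ℝ × Measure U))
    (hprob₁ : IsProbabilityMeasure ξ₁) (hprob₂ : IsProbabilityMeasure ξ₂)
    (hae₁ : ∀ᵐ p ∂ξ₁, IsProbabilityMeasure p.2)
    (hae₂ : ∀ᵐ p ∂ξ₂, IsProbabilityMeasure p.2)
    (hmom₁ : Integrable (fun p => p.1 ^ 2) ξ₁)
    (hmom₂ : Integrable (fun p => p.1 ^ 2) ξ₂) :
    W2 (fun (p q : ℝ × U) => (|p.1 - q.1| + dist p.2 q.2) ^ 2)
        (Pext U ξ₁) (Pext U ξ₂)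
      ≤ W2 (fun (p q : ℝ × Measure U) =>
            (|p.1 - q.1| + W2 (fun (u v : U) => dist u v ^ 2) p.2 q.2) ^ 2)
          ξ₁ ξ₂ := by
  classical
  -- setup
  have hcs : CompactSpace U := isCompact_iff_compactSpace.1 hU
  obtain ⟨p₀, hp₀⟩ := hae₁.exists
  obtain ⟨u₀⟩ : Nonempty U := nonempty_of_isProbabilityMeasure p₀.2
  have hne : Nonempty U := ⟨u₀⟩
  set R : ℝ := Metric.diam (Set.univ : Set U) with hRdef
  have hR0 : 0 ≤ R := Metric.diam_nonneg
  have hR : ∀ u v : U, dist u v ≤ R := fun u v =>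
    Metric.dist_le_diam_of_mem isCompact_univ.isBounded (Set.mem_univ _) (Set.mem_univ _)
  refine Real.sqrt_le_sqrt (le_csInf (Stmt4Aux.W2sq_nonempty (fun (p q : ℝ × Measure U) =>
    (|p.1 - q.1| + W2 (fun (u v : U) => dist u v ^ 2) p.2 q.2) ^ 2) ξ₁ ξ₂) ?_)
  rintro _ ⟨π, hπ₁, hπ₂, rfl⟩
  have hπ : IsProbabilityMeasure π := Stmt4Aux.prob_of_fst hπ₁
  -- kernels
  let κ₁ : Kernel ((ℝ × Measure U) × (ℝ × Measure U)) U :=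
    (Stmt4Aux.idk u₀).comap (fun s => s.1.2) (by fun_prop)
  let κ₂ : Kernel ((ℝ × Measure U) × (ℝ × Measure U)) U :=
    (Stmt4Aux.idk u₀).comap (fun s => s.2.2) (by fun_prop)
  let W : (ℝ × Measure U) × (ℝ × Measure U) → ℝ := fun s =>
    W2 (fun (u v : U) => dist u v ^ 2) (κ₁ s) (κ₂ s)
  have hWm : Measurable W := (Stmt4Aux.W2sq_meas κ₁ κ₂).sqrt
  have hW0 : ∀ s, 0 ≤ W s := fun s => Real.sqrt_nonneg _
  have hWsq : ∀ s, W s ^ 2 = W2sq (fun (u v : U) => dist u v ^ 2) (κ₁ s) (κ₂ s) := fun s =>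
    Real.sq_sqrt (Stmt4Aux.W2sq_nonneg _ _)
  have hWR : ∀ s, W s ≤ R := fun s =>
    Real.sqrt_le_iff.2 ⟨hR0, Stmt4Aux.W2sq_le hR _ _⟩
  have hae₁' : ∀ᵐ s ∂π, IsProbabilityMeasure s.1.2 := by
    rw [← hπ₁] at hae₁; exact ae_of_ae_map measurable_fst.aemeasurable hae₁
  have hae₂' : ∀ᵐ s ∂π, IsProbabilityMeasure s.2.2 := by
    rw [← hπ₂] at hae₂; exact ae_of_ae_map measurable_snd.aemeasurable hae₂
  have hcong : ∫ s, (|s.1.1 - s.2.1| + W2 (fun (u v : U) => dist u v ^ 2) s.1.2 s.2.2) ^ 2 ∂π =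
      ∫ s, (|s.1.1 - s.2.1| + W s) ^ 2 ∂π := by
    refine integral_congr_ae ?_
    filter_upwards [hae₁', hae₂'] with s h1 h2
    have e1 : κ₁ s = s.1.2 := Stmt4Aux.idk_apply u₀ s.1.2
    have e2 : κ₂ s = s.2.2 := Stmt4Aux.idk_apply u₀ s.2.2
    simp only [W, e1, e2]
  simp only
  rw [hcong]
  -- integrability
  have m₁ : Integrable (fun s => s.1.1 ^ 2) π := by
    rw [← hπ₁] at hmom₁; exact hmom₁.comp_measurable measurable_fst
  have m₂ : Integrable (fun s => s.2.1 ^ 2) π := by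
    rw [← hπ₂] at hmom₂; exact hmom₂.comp_measurable measurable_snd
  have hrm : Measurable (fun s : (ℝ × Measure U) × (ℝ × Measure U) => |s.1.1 - s.2.1|) := by
    fun_prop
  have hbd : ∀ (a b d : ℝ), 0 ≤ d → d ≤ R →
      (|a - b| + d) ^ 2 ≤ 4 * a ^ 2 + 4 * b ^ 2 + 2 * R ^ 2 := by
    intro a b d hd hdR
    have h1 : |a - b| ^ 2 = (a - b) ^ 2 := sq_abs _
    nlinarith [sq_nonneg (|a - b| - d), sq_nonneg (a + b)]
  have hdom : Integrable (fun s : (ℝ × Measure U) × (ℝ × Measure U) =>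
      4 * s.1.1 ^ 2 + 4 * s.2.1 ^ 2 + 2 * R ^ 2) π :=
    ((m₁.const_mul 4).add (m₂.const_mul 4)).add (integrable_const _)
  have iW : Integrable (fun s => (|s.1.1 - s.2.1| + W s) ^ 2) π := by
    refine hdom.mono' (by fun_prop) (.of_forall fun s => ?_)
    rw [Real.norm_eq_abs, abs_of_nonneg (sq_nonneg _)]
    exact hbd _ _ _ (hW0 s) (hWR s)
  have ir : Integrable (fun s => |s.1.1 - s.2.1|) π := by
    refine (hdom.add (integrable_const 1)).mono' hrm.aestronglyMeasurable (.of_forall fun s => ?_)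
    rw [Real.norm_eq_abs, abs_abs]
    have := hbd s.1.1 s.2.1 0 le_rfl hR0
    simp only [Pi.add_apply]
    nlinarith [sq_nonneg (|s.1.1 - s.2.1| - 1)]
  set M := ∫ s, |s.1.1 - s.2.1| ∂π with hM
  -- the estimate for fixed `η`
  have main : ∀ η : ℝ, 0 < η →
      W2sq (fun (p q : ℝ × U) => (|p.1 - q.1| + dist p.2 q.2) ^ 2) (Pext U ξ₁) (Pext U ξ₂) ≤
        ∫ s, (|s.1.1 - s.2.1| + W s) ^ 2 ∂π + η * (2 * M + η) := by
    intro η hη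
    obtain ⟨K, hKm, hK₁, hK₂, hKc⟩ := Stmt4Aux.exists_kernel hR0 hR κ₁ κ₂
      (show 0 < η ^ 2 by positivity)
    let Φ : ((ℝ × Measure U) × (ℝ × Measure U)) × (U × U) → (ℝ × U) × (ℝ × U) :=
      fun x => ((x.1.1.1, x.2.1), (x.1.2.1, x.2.2))
    have hΦ : Measurable Φ := by fun_prop
    have e₁ : ((π ⊗ₘ K).map Φ).map Prod.fst = Pext U ξ₁ := by
      rw [Measure.map_map measurable_fst hΦ]
      exact Stmt4Aux.marg U ξ₁ hae₁ u₀ π Prod.fst measurable_fst hπ₁ K Prod.fst measurable_fst hK₁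
    have e₂ : ((π ⊗ₘ K).map Φ).map Prod.snd = Pext U ξ₂ := by
      rw [Measure.map_map measurable_snd hΦ]
      exact Stmt4Aux.marg U ξ₂ hae₂ u₀ π Prod.snd measurable_snd hπ₂ K Prod.snd measurable_snd hK₂
    refine (Stmt4Aux.W2sq_le_int (fun u v => sq_nonneg _) e₁ e₂).trans ?_
    have hcm : Measurable fun p : (ℝ × U) × (ℝ × U) =>
        (|p.1.1 - p.2.1| + dist p.1.2 p.2.2) ^ 2 := by fun_prop
    rw [integral_map hΦ.aemeasurable hcm.aestronglyMeasurable]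
    have hfst : (π ⊗ₘ K).map Prod.fst = π := by
      have := Measure.fst_compProd π K
      exact this
    have iΦ : Integrable (fun x : ((ℝ × Measure U) × (ℝ × Measure U)) × (U × U) =>
        (|x.1.1.1 - x.1.2.1| + dist x.2.1 x.2.2) ^ 2) (π ⊗ₘ K) := by
      have hd : Integrable (fun x : ((ℝ × Measure U) × (ℝ × Measure U)) × (U × U) =>
          4 * x.1.1.1 ^ 2 + 4 * x.1.2.1 ^ 2 + 2 * R ^ 2) (π ⊗ₘ K) := by
        rw [← hfst] at hdom
        exact hdom.comp_measurable measurable_fst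
      refine hd.mono' (hcm.comp hΦ).aestronglyMeasurable (.of_forall fun x => ?_)
      rw [Real.norm_eq_abs, abs_of_nonneg (sq_nonneg _)]
      exact hbd _ _ _ dist_nonneg (hR _ _)
    have e3 := Measure.integral_compProd iΦ
    refine (le_of_eq e3).trans ?_
    have ibd : Integrable (fun s => η * (2 * |s.1.1 - s.2.1| + η)) π :=
      ((ir.const_mul 2).add (integrable_const η)).const_mul η
    calc _ ≤ ∫ s, ((|s.1.1 - s.2.1| + W s) ^ 2 + η * (2 * |s.1.1 - s.2.1| + η)) ∂π := by
          refine integral_mono_of_nonneg (.of_forall fun s => integral_nonneg fun p => sq_nonneg _)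
            (iW.add ibd) (.of_forall fun s => ?_)
          refine Stmt4Aux.inner_est hR (K s) (abs_nonneg (s.1.1 - s.2.1)) (hW0 s) hη ?_
          rw [hWsq]; exact hKc s
      _ = _ := by
          rw [integral_add iW ibd, integral_const_mul, integral_add (ir.const_mul 2)
            (integrable_const η), integral_const_mul]
          simp [hM]
  -- let `η → 0`
  have hlim : Filter.Tendsto (fun η : ℝ =>
      ∫ s, (|s.1.1 - s.2.1| + W s) ^ 2 ∂π + η * (2 * M + η)) (nhdsWithin 0 (Set.Ioi 0))
      (nhds (∫ s, (|s.1.1 - s.2.1| + W s) ^ 2 ∂π)) := by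
    have : Continuous (fun η : ℝ =>
      ∫ s, (|s.1.1 - s.2.1| + W s) ^ 2 ∂π + η * (2 * M + η)) := by fun_prop
    have h := (this.tendsto 0).mono_left (nhdsWithin_le_nhds (s := Set.Ioi 0))
    simpa using h
  exact ge_of_tendsto hlim (Filter.eventually_of_mem self_mem_nhdsWithin fun η hη => main η hη)
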